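/- arXiv:2102.00332 — 4 statements merged into one kernel-verified Lean document; each statement's English description precedes it below -/
import Mathlib

section
/- Let m>1 and 0<p<1 be reals, N≥1 an integer, σ=2(1−p)/(m−1), α>0 and β=(m−1)α/2, and set K = (1/m)(2m/α)^{(m−p)/(m−1)}. Let I⊆(0,∞) be an open interval and let f:I→(0,∞) be twice continuously differentiable and satisfy the profile ODE (f^m)''(ξ) + ((N−1)/ξ)(f^m)'(ξ) − α f(ξ) + β ξ f'(ξ) + ξ^σ f(ξ)^p = 0 on I. Define, for η with e^η∈I, X(η) = (α/(2m)) e^{2η} f(e^η)^{1−m} and Y(η) = e^η f'(e^η)/f(e^η). Then X and Y are differentiable and satisfy the phase-plane system X'(η) = X(η)(2−(m−1)Y(η)) and Y'(η) = −m Y(η)² − (N−2) Y(η) + 2X(η) − (m−1) X(η) Y(η) − K X(η)^{(m−p)/(m−1)}. -/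
open Real Set Filter Topology

noncomputable section

/-- The self-similar profile ODE
`(f^m)'' + ((N-1)/ξ)(f^m)' - α f + β ξ f' + ξ^σ f^p = 0` at the point `ξ`. -/
def ProfileODE (m p σ α β : ℝ) (N : ℕ) (f : ℝ → ℝ) (ξ : ℝ) : Prop :=
  deriv (deriv (fun x => f x ^ m)) ξ + ((N : ℝ) - 1) / ξ * deriv (fun x => f x ^ m) ξ
    - α * f ξ + β * ξ * deriv f ξ + ξ ^ σ * f ξ ^ p = 0

/-- The phase-plane variable `X(η) = (α/(2m)) e^{2η} f(e^η)^{1-m}`. -/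
def Xvar (m α : ℝ) (f : ℝ → ℝ) (η : ℝ) : ℝ :=
  α / (2 * m) * Real.exp (2 * η) * f (Real.exp η) ^ (1 - m)

/-- The phase-plane variable `Y(η) = e^η f'(e^η) / f(e^η)`. -/
def Yvar (f : ℝ → ℝ) (η : ℝ) : ℝ :=
  Real.exp η * deriv f (Real.exp η) / f (Real.exp η)

/-- The second derivative of `f ^ m` at a point near which `f` is positive and twice
differentiable. -/
theorem deriv_deriv_rpow {m ξ : ℝ} {f : ℝ → ℝ} (hpos : ∀ᶠ x in 𝓝 ξ, 0 < f x)
    (hdiff : ∀ᶠ x in 𝓝 ξ, DifferentiableAt ℝ f x) (hdiff' : DifferentiableAt ℝ (deriv f) ξ) :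
    deriv (deriv (fun x => f x ^ m)) ξ =
      deriv (deriv f) ξ * m * f ξ ^ (m - 1) +
        deriv f ξ * m * (deriv f ξ * (m - 1) * f ξ ^ (m - 1 - 1)) := by
  have hderiv : deriv (fun x => f x ^ m) =ᶠ[𝓝 ξ] fun x => deriv f x * m * f x ^ (m - 1) := by
    filter_upwards [hpos, hdiff] with x hx hdx
    exact (hdx.hasDerivAt.rpow_const (Or.inl hx.ne')).deriv
  rw [hderiv.deriv_eq]
  exact ((hdiff'.hasDerivAt.mul_const m).mul
    (hdiff.self_of_nhds.hasDerivAt.rpow_const (Or.inl hpos.self_of_nhds.ne'))).deriv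

/-- The source term of the phase-plane system in terms of `ξ` and `F = f ξ`. -/
theorem source_term_eq {m p α ξ F : ℝ} (hm : 1 < m) (hα : 0 < α) (hξ : 0 < ξ) (hF : 0 < F) :
    (2 * m / α) ^ ((m - p) / (m - 1)) *
        (α / (2 * m) * ξ ^ 2 * F ^ (1 - m)) ^ ((m - p) / (m - 1)) =
      ξ ^ 2 * ξ ^ (2 * (1 - p) / (m - 1)) * F ^ p / F ^ m := by
  have hm0 : 0 < m := by linarith
  have hm1 : m - 1 ≠ 0 := by linarith
  have hFm : 0 < F ^ (1 - m) := rpow_pos_of_pos hF _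
  have hcancel : 2 * m / α * (α / (2 * m) * ξ ^ 2 * F ^ (1 - m)) = ξ ^ 2 * F ^ (1 - m) := by
    field_simp
  rw [← mul_rpow (by positivity) (by positivity), hcancel,
    mul_rpow (by positivity) hFm.le, ← rpow_mul hF.le, ← rpow_natCast, ← rpow_mul hξ.le,
    ← rpow_add hξ, mul_div_assoc, ← rpow_sub hF]
  congr 2
  · push_cast
    field_simp
    ring
  · field_simp
    ring

/-- The logarithmic variable `X` satisfies its equation wherever `f` is positive and
differentiable. -/
theorem hasDerivAt_Xvar {m α η : ℝ} {f : ℝ → ℝ} (hpos : 0 < f (Real.exp η))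
    (hdiff : DifferentiableAt ℝ f (Real.exp η)) :
    HasDerivAt (Xvar m α f) (Xvar m α f η * (2 - (m - 1) * Yvar f η)) η := by
  have hexp2 : HasDerivAt (fun t : ℝ => Real.exp (2 * t)) (Real.exp (2 * η) * (2 * 1)) η :=
    ((hasDerivAt_id η).const_mul 2).exp
  have hcomp : HasDerivAt (fun t => f (Real.exp t)) (deriv f (Real.exp η) * Real.exp η) η :=
    hdiff.hasDerivAt.comp η (Real.hasDerivAt_exp η)
  have hX := (hexp2.const_mul (α / (2 * m))).mul
    (hcomp.rpow_const (p := 1 - m) (Or.inl hpos.ne'))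
  refine hX.congr_deriv ?_
  rw [rpow_sub_one hpos.ne']
  simp only [Xvar, Yvar]
  field_simp
  ring

/-- The derivative of the logarithmic derivative `Y`. -/
theorem hasDerivAt_Yvar {η : ℝ} {f : ℝ → ℝ} (hne : f (Real.exp η) ≠ 0)
    (hdiff : DifferentiableAt ℝ f (Real.exp η))
    (hdiff' : DifferentiableAt ℝ (deriv f) (Real.exp η)) :
    HasDerivAt (Yvar f) (Yvar f η - Yvar f η ^ 2 +
      Real.exp η ^ 2 * deriv (deriv f) (Real.exp η) / f (Real.exp η)) η := by
  have hexp := Real.hasDerivAt_exp η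
  have hcomp : HasDerivAt (fun t => f (Real.exp t)) (deriv f (Real.exp η) * Real.exp η) η :=
    hdiff.hasDerivAt.comp η hexp
  have hcomp' : HasDerivAt (fun t => deriv f (Real.exp t))
      (deriv (deriv f) (Real.exp η) * Real.exp η) η :=
    hdiff'.hasDerivAt.comp η hexp
  refine ((hexp.mul hcomp').div hcomp hne).congr_deriv ?_
  simp only [Yvar, Pi.mul_apply]
  field_simp
  ring

/-- The change of variables `X = (α/(2m)) ξ² f(ξ)^{1-m}`, `Y = ξ f'(ξ)/f(ξ)`, `ξ = e^η`
transforms the profile ODE into the autonomous phase-plane system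
`X' = X(2-(m-1)Y)`, `Y' = -mY² - (N-2)Y + 2X - (m-1)XY - K X^{(m-p)/(m-1)}`,
with `K = (1/m)(2m/α)^{(m-p)/(m-1)}`. -/
theorem phase_plane_system (m p α : ℝ) (N : ℕ)
    (hm : 1 < m) (hp0 : 0 < p) (hp1 : p < 1) (hN : 1 ≤ N) (hα : 0 < α)
    (I : Set ℝ) (hIopen : IsOpen I) (hIsub : I ⊆ Ioi 0) (hIconn : I.OrdConnected)
    (f : ℝ → ℝ) (hfpos : ∀ ξ ∈ I, 0 < f ξ) (hfsmooth : ContDiffOn ℝ 2 f I)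
    (hode : ∀ ξ ∈ I, ProfileODE m p (2 * (1 - p) / (m - 1)) α ((m - 1) * α / 2) N f ξ) :
    ∀ η : ℝ, Real.exp η ∈ I →
      HasDerivAt (Xvar m α f) (Xvar m α f η * (2 - (m - 1) * Yvar f η)) η ∧
      HasDerivAt (Yvar f)
        (-m * Yvar f η ^ 2 - ((N : ℝ) - 2) * Yvar f η + 2 * Xvar m α f η
          - (m - 1) * Xvar m α f η * Yvar f η
          - (1 / m) * (2 * m / α) ^ ((m - p) / (m - 1)) *
              Xvar m α f η ^ ((m - p) / (m - 1))) η := by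
  intro η hη
  have hpos := hfpos _ hη
  have hnhds : I ∈ 𝓝 (Real.exp η) := hIopen.mem_nhds hη
  have hdiffOn : DifferentiableOn ℝ f I := hfsmooth.differentiableOn (by norm_num)
  have hdiff : DifferentiableAt ℝ f (Real.exp η) := hdiffOn.differentiableAt hnhds
  have hdiff' : DifferentiableAt ℝ (deriv f) (Real.exp η) :=
    ((hfsmooth.deriv_of_isOpen (m := 1) hIopen (by norm_num)).differentiableOn
      (by norm_num)).differentiableAt hnhds
  refine ⟨hasDerivAt_Xvar hpos hdiff,
    (hasDerivAt_Yvar hpos.ne' hdiff hdiff').congr_deriv ?_⟩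
  have hode' := hode _ hη
  unfold ProfileODE at hode'
  rw [deriv_deriv_rpow (Filter.mem_of_superset hnhds hfpos)
      (Filter.mem_of_superset hnhds fun x hx => hdiffOn.differentiableAt (hIopen.mem_nhds hx))
      hdiff',
    (hdiff.hasDerivAt.rpow_const (p := m) (Or.inl hpos.ne')).deriv,
    rpow_sub_one hpos.ne' (m - 1), rpow_sub_one hpos.ne' m] at hode'
  have hexp2 : Real.exp (2 * η) = Real.exp η ^ 2 := by
    rw [← Real.exp_nat_mul]
    norm_num
  simp only [Xvar, Yvar, hexp2]
  rw [mul_assoc (1 / m), source_term_eq hm hα (Real.exp_pos η) hpos, rpow_sub hpos, rpow_one]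
  have hξ := Real.exp_pos η
  have hM : 0 < f (Real.exp η) ^ m := rpow_pos_of_pos hpos m
  have hm0 : m ≠ 0 := by linarith
  generalize Real.exp η ^ (2 * (1 - p) / (m - 1)) = S at *
  generalize f (Real.exp η) ^ p = P at *
  generalize f (Real.exp η) ^ m = M at *
  generalize deriv (deriv f) (Real.exp η) = f₂ at *
  generalize deriv f (Real.exp η) = f₁ at *
  generalize f (Real.exp η) = F at *
  generalize Real.exp η = ξ at *
  rw [← sub_eq_zero]
  have hscaled := congrArg (fun t => ξ ^ 2 / (m * M) * t) hode'
  simp only [mul_zero] at hscaled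
  rw [← hscaled]
  field_simp
  ring
end
end

section
/- Let m>1 and 0<p<1 be reals with m+p>2, and let N≥3 be an integer. Then there exists K₀>0 such that for every K∈(0,K₀) and every X≥0, Δ_K(X) = (m−1)²X² + 2(mN+2m−N+2)X + (N−2)² − 4KmX^{(m−p)/(m−1)} > 0. -/
open Real Set Filter Topology

noncomputable section

/-- The discriminant `Δ_K(X)` of the isocline `{Ẏ = 0}` of the phase-plane system. -/
def DeltaK (m p K : ℝ) (N : ℕ) (X : ℝ) : ℝ :=
  (m - 1) ^ 2 * X ^ 2 + 2 * (m * N + 2 * m - N + 2) * X + ((N : ℝ) - 2) ^ 2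
    - 4 * K * m * X ^ ((m - p) / (m - 1))

/-- The upper branch `Y₁(X)` of the isocline `{Ẏ = 0}`. -/
def Ybranch (m p K : ℝ) (N : ℕ) (X : ℝ) : ℝ :=
  (-((N : ℝ) - 2) - (m - 1) * X + Real.sqrt (DeltaK m p K N X)) / (2 * m)

/-- The value `X₀(K) = (2/K)^{(m-1)/(1-p)}` where `Y₁` vanishes. -/
def Xzero (m p K : ℝ) : ℝ := (2 / K) ^ ((m - 1) / (1 - p))

/-- For `m + p > 2` and `N ≥ 3`, the discriminant `Δ_K` is strictly positive on `[0,∞)`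
for every sufficiently small `K > 0`. -/
theorem discriminant_pos_small_K (m p : ℝ) (N : ℕ)
    (hm : 1 < m) (hp0 : 0 < p) (hp1 : p < 1) (hmp : 2 < m + p) (hN : 3 ≤ N) :
    ∃ K₀ : ℝ, 0 < K₀ ∧ ∀ K : ℝ, 0 < K → K < K₀ →
      ∀ X : ℝ, 0 ≤ X → 0 < DeltaK m p K N X := by
  have hm0 : 0 < m - 1 := by linarith
  refine ⟨min ((m - 1) ^ 2) 1 / (4 * m), by positivity, fun K hK hK₀ X hX => ?_⟩
  rw [lt_div_iff₀ (by positivity), lt_min_iff] at hK₀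
  obtain ⟨h₁, h₂⟩ := hK₀
  have he0 : 0 ≤ (m - p) / (m - 1) := div_nonneg (by linarith) hm0.le
  have he2 : (m - p) / (m - 1) ≤ 2 := by
    rw [div_le_iff₀ hm0]
    linarith
  have hpow : X ^ ((m - p) / (m - 1)) ≤ 1 + X ^ 2 := by
    rcases le_total X 1 with h | h
    · have := rpow_le_one hX h he0
      nlinarith [sq_nonneg X]
    · have := rpow_le_rpow_of_exponent_le h he2
      rw [rpow_two] at this
      linarith
  have hN' : (3 : ℝ) ≤ N := by exact_mod_cast hN
  have hlin : 0 ≤ 2 * (m * N + 2 * m - N + 2) * X := by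
    refine mul_nonneg ?_ hX
    nlinarith
  have hKm : 0 < K * (4 * m) := by positivity
  have hbound := mul_le_mul_of_nonneg_left hpow hKm.le
  have hsq := mul_le_mul_of_nonneg_right h₁.le (sq_nonneg X)
  have hconst : (1 : ℝ) ≤ ((N : ℝ) - 2) ^ 2 := by nlinarith
  unfold DeltaK
  linarith
end
end

section
/- Let m>1 and 0<p<1 be reals with m+p>2, and let N≥3 be an integer. Then there exists K₀>0 such that for every K∈(0,K₀): Δ_K(X)>0 for all X≥0, and the branch Y₁(X) = (−(N−2) − (m−1)X + √(Δ_K(X)))/(2m) satisfies Y₁(X)>0 for 0<X<X₀(K), Y₁(X₀(K))=0, and Y₁(X)<0 for X>X₀(K), where X₀(K) = (2/K)^{(m−1)/(1−p)}. -/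
open Real Set Filter Topology

noncomputable section

theorem rpow_le_self_add_sq {a X : ℝ} (ha1 : 1 ≤ a) (ha2 : a ≤ 2) (hX : 0 ≤ X) :
    X ^ a ≤ X + X ^ 2 := by
  rcases le_total X 1 with h | h
  · have := Real.rpow_le_rpow_of_exponent_ge' hX h zero_le_one ha1
    rw [Real.rpow_one] at this
    nlinarith [sq_nonneg X]
  · have := Real.rpow_le_rpow_of_exponent_le h ha2
    rw [Real.rpow_two] at this
    linarith

theorem DeltaK_eq_sq_add {m p K X : ℝ} (N : ℕ) (hm : 1 < m) (hX : 0 < X) :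
    DeltaK m p K N X = ((N - 2 : ℝ) + (m - 1) * X) ^ 2
      + 4 * m * X * (2 - K * X ^ ((1 - p) / (m - 1))) := by
  have hm' : m - 1 ≠ 0 := by linarith
  have he : (m - p) / (m - 1) = (1 - p) / (m - 1) + 1 := by
    field_simp
    ring
  rw [DeltaK, he, Real.rpow_add_one hX.ne']
  ring

theorem DeltaK_pos {m p K X : ℝ} {N : ℕ} (hm : 1 < m) (hp1 : p < 1) (hmp : 2 < m + p)
    (hN : 3 ≤ N) (hK0 : 0 < K) (hK1 : K < 1) (hK : K < (m - 1) ^ 2 / (4 * m)) (hX : 0 ≤ X) :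
    0 < DeltaK m p K N X := by
  have hm' : 0 < m - 1 := by linarith
  have hNR : (3 : ℝ) ≤ N := by exact_mod_cast hN
  have ha := rpow_le_self_add_sq (a := (m - p) / (m - 1))
    ((one_le_div hm').2 (by linarith)) ((div_le_iff₀ hm').2 (by linarith)) hX
  rw [lt_div_iff₀ (by linarith)] at hK
  have h1 : 4 * K * m * X ^ ((m - p) / (m - 1)) ≤ 4 * K * m * (X + X ^ 2) :=
    mul_le_mul_of_nonneg_left ha (by positivity)
  have h2 : 4 * K * m * X ^ 2 ≤ (m - 1) ^ 2 * X ^ 2 :=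
    mul_le_mul_of_nonneg_right (by linarith) (sq_nonneg X)
  have h3 : 4 * K * m * X ≤ 2 * (m * N + 2 * m - N + 2) * X :=
    mul_le_mul_of_nonneg_right (by nlinarith) hX
  have h4 : 0 < ((N : ℝ) - 2) ^ 2 := pow_pos (by linarith) 2
  rw [DeltaK]
  linarith

theorem Xzero_pos {m p K : ℝ} (hK : 0 < K) : 0 < Xzero m p K :=
  Real.rpow_pos_of_pos (by positivity) _

theorem mul_Xzero_rpow {m p K : ℝ} (hm : 1 < m) (hp1 : p < 1) (hK : 0 < K) :
    K * Xzero m p K ^ ((1 - p) / (m - 1)) = 2 := by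
  have hm' : m - 1 ≠ 0 := by linarith
  have hp' : 1 - p ≠ 0 := by linarith
  rw [Xzero, ← Real.rpow_mul (by positivity), div_mul_div_cancel₀ hp', div_self hm',
    Real.rpow_one]
  field_simp

/-- For `m + p > 2`, `N ≥ 3` and `K > 0` small, the branch `Y₁` is positive on
`(0, X₀(K))`, vanishes at `X₀(K) = (2/K)^{(m-1)/(1-p)}` and is negative on `(X₀(K), ∞)`. -/
theorem branch_sign (m p : ℝ) (N : ℕ)
    (hm : 1 < m) (hp0 : 0 < p) (hp1 : p < 1) (hmp : 2 < m + p) (hN : 3 ≤ N) :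
    ∃ K₀ : ℝ, 0 < K₀ ∧ ∀ K : ℝ, 0 < K → K < K₀ →
      (∀ X : ℝ, 0 ≤ X → 0 < DeltaK m p K N X) ∧
      (∀ X : ℝ, 0 < X → X < Xzero m p K → 0 < Ybranch m p K N X) ∧
      Ybranch m p K N (Xzero m p K) = 0 ∧
      (∀ X : ℝ, Xzero m p K < X → Ybranch m p K N X < 0) := by
  have hm' : 0 < m - 1 := by linarith
  have hNR : (3 : ℝ) ≤ N := by exact_mod_cast hN
  have hb : 0 < (1 - p) / (m - 1) := div_pos (by linarith) hm'
  refine ⟨min 1 ((m - 1) ^ 2 / (4 * m)), by positivity, fun K hK0 hK ↦ ?_⟩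
  obtain ⟨hK1, hK2⟩ := lt_min_iff.1 hK
  have hX₀ : 0 < Xzero m p K := Xzero_pos hK0
  have hroot := mul_Xzero_rpow hm hp1 hK0
  refine ⟨fun X hX ↦ DeltaK_pos hm hp1 hmp hN hK0 hK1 hK2 hX, fun X hX hlt ↦ ?_, ?_,
    fun X hlt ↦ ?_⟩
  · have hc : K * X ^ ((1 - p) / (m - 1)) < 2 :=
      hroot ▸ mul_lt_mul_of_pos_left (Real.rpow_lt_rpow hX.le hlt hb) hK0
    have hq : (N - 2 : ℝ) + (m - 1) * X < √(DeltaK m p K N X) := by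
      apply Real.lt_sqrt_of_sq_lt
      rw [DeltaK_eq_sq_add N hm hX]
      exact lt_add_of_pos_right _ (mul_pos (by positivity) (by linarith))
    exact div_pos (by linarith) (by linarith)
  · have hq : √(DeltaK m p K N (Xzero m p K)) = (N - 2 : ℝ) + (m - 1) * Xzero m p K := by
      rw [DeltaK_eq_sq_add N hm hX₀, hroot, sub_self, mul_zero, add_zero]
      exact Real.sqrt_sq (add_nonneg (by linarith) (by positivity))
    rw [Ybranch, hq]
    ring
  · have hX : 0 < X := hX₀.trans hlt
    have hc : 2 < K * X ^ ((1 - p) / (m - 1)) :=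
      hroot ▸ mul_lt_mul_of_pos_left (Real.rpow_lt_rpow hX₀.le hlt hb) hK0
    have hq : √(DeltaK m p K N X) < (N - 2 : ℝ) + (m - 1) * X := by
      rw [Real.sqrt_lt' (add_pos (by linarith) (by positivity)), DeltaK_eq_sq_add N hm hX]
      exact add_lt_of_neg_right _ (mul_neg_of_pos_of_neg (by positivity) (by linarith))
    exact div_neg_of_neg_of_pos (by linarith) (by linarith)
end
end

section
/- Let m>1 and 0<p<1 be reals with m+p>2, let N≥3 be an integer, and let λ>0 be fixed. Then there exists K₁>0 such that for every K>K₁, setting D=λK, one has F(X) = (Dm² − Dm + mN − N + 2)X − mD² − (N−2)D − K X^{(m−p)/(m−1)} < 0 for every X ≥ 0. (Consequently the straight line (m−1)X + Y = D cannot be crossed from left to right by trajectories of the phase-plane system.) -/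
open Real Set Filter Topology

noncomputable section

/-- A superlinear power dominates any linear function up to an additive constant. -/
theorem exists_linear_le_add_rpow {q C : ℝ} (hq : 1 < q) (hC : 0 < C) :
    ∃ B : ℝ, 0 < B ∧ ∀ X : ℝ, 0 ≤ X → C * X ≤ B + X ^ q := by
  have hM : 0 < C ^ (q - 1)⁻¹ := rpow_pos_of_pos hC _
  refine ⟨C * C ^ (q - 1)⁻¹, mul_pos hC hM, fun X hX => ?_⟩
  rcases le_total X (C ^ (q - 1)⁻¹) with h | h
  · have := mul_le_mul_of_nonneg_left h hC.le
    have := rpow_nonneg hX q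
    linarith
  · have hX' : 0 < X := hM.trans_le h
    have hle : C ≤ X ^ (q - 1) := by
      have := rpow_le_rpow hM.le h (sub_pos.2 hq).le
      rwa [rpow_inv_rpow hC.le (sub_pos.2 hq).ne'] at this
    have heq : X ^ q = X ^ (q - 1) * X := by
      rw [← rpow_add_one hX'.ne', sub_add_cancel]
    have := mul_le_mul_of_nonneg_right hle hX
    have := mul_pos hC hM
    linarith

/-- For `m + p > 2`, `N ≥ 3` and fixed `λ > 0`, for every sufficiently large `K`, the flow
of the phase-plane system across the line `(m-1)X + Y = D` with `D = λK`, measured by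
`F(X) = (Dm² - Dm + mN - N + 2)X - mD² - (N-2)D - K X^{(m-p)/(m-1)}`, is negative for
all `X ≥ 0`; hence the line cannot be crossed from left to right by trajectories. -/
theorem line_barrier_large_K (m p l : ℝ) (N : ℕ)
    (hm : 1 < m) (hp0 : 0 < p) (hp1 : p < 1) (hmp : 2 < m + p) (hN : 3 ≤ N)
    (hl : 0 < l) :
    ∃ K₁ : ℝ, 0 < K₁ ∧ ∀ K : ℝ, K₁ < K →
      ∀ X : ℝ, 0 ≤ X →
        ((l * K) * m ^ 2 - (l * K) * m + m * N - N + 2) * X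
          - m * (l * K) ^ 2 - ((N : ℝ) - 2) * (l * K)
          - K * X ^ ((m - p) / (m - 1)) < 0 := by
  have hN' : (3 : ℝ) ≤ N := by exact_mod_cast hN
  have hm1 : 0 < m - 1 := by linarith
  have hm0 : 0 < m := by linarith
  have hq : 1 < (m - p) / (m - 1) := by rw [lt_div_iff₀ hm1]; linarith
  have hc : 0 < (m - 1) * N + 2 := by positivity
  have hC : 0 < l * m * (m - 1) + ((m - 1) * N + 2) := by positivity
  obtain ⟨B, hB, h⟩ := exists_linear_le_add_rpow hq hC
  refine ⟨1 + B / (m * l ^ 2), by positivity, fun K hK X hX => ?_⟩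
  have hBl : 0 < B / (m * l ^ 2) := by positivity
  have hK1 : 1 < K := by linarith
  have hK0 : 0 < K := by linarith
  have hBK : B < K * (m * l ^ 2) := by
    rw [← div_lt_iff₀ (by positivity)]
    linarith
  have hlin := mul_le_mul_of_nonneg_left (h X hX) hK0.le
  have hconst := mul_lt_mul_of_pos_left hBK hK0
  have hcoef : 0 ≤ (K - 1) * (((m - 1) * N + 2) * X) :=
    mul_nonneg (by linarith) (mul_nonneg hc.le hX)
  have hD : 0 < ((N : ℝ) - 2) * (l * K) := mul_pos (by linarith) (mul_pos hl hK0)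
  linarith
end
end
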